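/- Let $c_v > 0$, $\gamma = 1 + 1/c_v$, define $H_\Theta(\varrho, p) = c_v p - \Theta\, c_v\, \varrho \log(p/\varrho^{\gamma})$ for $\varrho, p > 0$, and let $K \subset (0,\infty)^2$ be compact. Then there exist $\delta > 0$ and $c > 0$ such that for every $(r, \Theta) \in K$ and every $(\varrho, p) \in (0,\infty)^2$ with $|\varrho - r| + |p - r\Theta| \ge \delta$, $H_\Theta(\varrho, p) - H_\Theta(r, r\Theta) - \partial_\varrho H_\Theta(r, r\Theta)\,(\varrho - r) - \partial_p H_\Theta(r, r\Theta)\,(p - r\Theta) \ \ge\ c\,\Big(1 + \varrho + c_v\,\varrho\,\big|\log(p/\varrho^{\gamma})\big| + p\Big)$. -/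

import Mathlib

/-- `H_Θ(ϱ, p) = c_v p - Θ c_v ϱ log (p / ϱ^γ)`. -/
noncomputable def Hfun (c_v γ Θ ϱ p : ℝ) : ℝ :=
  c_v * p - Θ * c_v * ϱ * Real.log (p / ϱ ^ γ)

/-- The Bregman divergence of `H_Θ` at the point `(r, rΘ)`. -/
noncomputable def Breg (c_v γ Θ r ϱ p : ℝ) : ℝ :=
  Hfun c_v γ Θ ϱ p - Hfun c_v γ Θ r (r * Θ)
    - deriv (fun ϱ' => Hfun c_v γ Θ ϱ' (r * Θ)) r * (ϱ - r)
    - deriv (fun p' => Hfun c_v γ Θ r p') (r * Θ) * (p - r * Θ)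

/-- The Bregman divergence of `H_Θ` at `(r, rΘ)`, written in the normalized variables
`x = ϱ / r` and `y = p / (rΘ)`. -/
lemma Breg_eq (c_v γ Θ r x y : ℝ) (hc_v : 0 < c_v) (hγ : γ = 1 + 1 / c_v)
    (hΘ : 0 < Θ) (hr : 0 < r) (hx : 0 < x) (hy : 0 < y) :
    Breg c_v γ Θ r (r * x) (r * Θ * y) =
      r * Θ * ((x * Real.log x - x + 1) + c_v * (y - x - x * Real.log (y / x))) := by
  have hrΘ : 0 < r * Θ := mul_pos hr hΘ
  have hlog : ∀ a b : ℝ, 0 < a → 0 < b →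
      Real.log (b / a ^ γ) = Real.log b - γ * Real.log a := fun a b ha hb => by
    rw [Real.log_div hb.ne' (Real.rpow_pos_of_pos ha γ).ne', Real.log_rpow ha]
  have hd1 : deriv (fun ϱ' => Hfun c_v γ Θ ϱ' (r * Θ)) r =
      -(Θ * c_v) * (Real.log (r * Θ) - γ * Real.log r - γ) := by
    have heq : (fun ϱ' => Hfun c_v γ Θ ϱ' (r * Θ)) =ᶠ[nhds r] fun ϱ' =>
        c_v * (r * Θ) - Θ * c_v * ϱ' * (Real.log (r * Θ) - γ * Real.log ϱ') := by
      filter_upwards [eventually_gt_nhds hr] with a ha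
      rw [Hfun, hlog a _ ha hrΘ]
    rw [heq.deriv_eq]
    refine HasDerivAt.deriv ?_
    refine ((((hasDerivAt_id' r).const_mul (Θ * c_v)).mul
      (((Real.hasDerivAt_log hr.ne').const_mul γ).const_sub (Real.log (r * Θ)))).const_sub
        (c_v * (r * Θ))).congr_deriv ?_
    field_simp
    ring
  have hd2 : deriv (fun p' => Hfun c_v γ Θ r p') (r * Θ) = 0 := by
    have heq : (fun p' => Hfun c_v γ Θ r p') =ᶠ[nhds (r * Θ)] fun p' =>
        c_v * p' - Θ * c_v * r * (Real.log p' - γ * Real.log r) := by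
      filter_upwards [eventually_gt_nhds hrΘ] with a ha
      rw [Hfun, hlog r _ hr ha]
    rw [heq.deriv_eq]
    refine HasDerivAt.deriv ?_
    refine (((hasDerivAt_id' (r * Θ)).const_mul c_v).sub
      (((Real.hasDerivAt_log hrΘ.ne').sub_const (γ * Real.log r)).const_mul
        (Θ * c_v * r))).congr_deriv ?_
    field_simp
    ring
  rw [Breg, hd1, hd2, Hfun, Hfun, hlog _ _ hr hrΘ, hlog _ _ (mul_pos hr hx) (mul_pos hrΘ hy),
    Real.log_mul hrΘ.ne' hy.ne', Real.log_mul hr.ne' hx.ne', Real.log_div hy.ne' hx.ne', hγ]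
  field_simp
  ring

lemma le_mul_log_sub_add_three {x : ℝ} (hx : 0 < x) : x ≤ (x * Real.log x - x + 1) + 2 := by
  have h := Real.add_one_le_exp (1 - Real.log x)
  rw [Real.exp_sub, Real.exp_log hx, le_div_iff₀ hx] at h
  have := Real.exp_one_lt_d9
  nlinarith

lemma mul_abs_log_le {x : ℝ} (hx : 0 < x) :
    x * |Real.log x| ≤ (x * Real.log x - x + 1) + x + 1 := by
  have h := Real.one_sub_inv_le_log_of_pos hx
  have h' : x - 1 ≤ x * Real.log x := by
    have := mul_le_mul_of_nonneg_left h hx.le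
    rwa [mul_sub, mul_inv_cancel₀ hx.ne', mul_one] at this
  rcases abs_cases (Real.log x) with ⟨e, -⟩ | ⟨e, -⟩ <;> rw [e] <;> linarith

lemma two_mul_log_le {t : ℝ} (ht : 0 < t) : 2 * Real.log t ≤ t := by
  have h := Real.log_le_sub_one_of_pos (half_pos ht)
  rw [Real.log_div ht.ne' two_ne_zero] at h
  have := Real.log_two_lt_d9
  linarith

lemma abs_log_le_sub_log {t : ℝ} (ht : 0 < t) : |Real.log t| ≤ t - Real.log t := by
  have := two_mul_log_le ht
  rcases abs_cases (Real.log t) with ⟨e, -⟩ | ⟨e, -⟩ <;> rw [e] <;> linarith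

/-- Coercivity of the Bregman divergence of `H_Θ` in normalized variables. -/
lemma coercivity_normalized {c_v C x y : ℝ} (hc_v : 0 < c_v) (hC : 0 < C)
    (hx : 0 < x) (hy : 0 < y) :
    1 + C * x + c_v * (C * x) * (C + |Real.log (y / x)| + 1 / c_v * |Real.log x|) + C * y ≤
      (C * (6 + 2 / c_v + c_v * C + c_v)) *
          ((x * Real.log x - x + 1) + c_v * (y - x - x * Real.log (y / x))) +
        (1 + C * (9 + 2 * c_v * C + 2 * c_v)) := by
  have hxy : 0 < y / x := div_pos hy hx
  have hφ := Real.one_sub_inv_le_log_of_pos hx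
  have hφ0 : 0 ≤ x * Real.log x - x + 1 := by
    have := mul_le_mul_of_nonneg_left hφ hx.le
    rw [mul_sub, mul_inv_cancel₀ hx.ne', mul_one] at this
    linarith
  have hyx : x * (y / x) = y := mul_div_cancel₀ y hx.ne'
  have hψ0 : 0 ≤ y - x - x * Real.log (y / x) := by
    have := mul_le_mul_of_nonneg_left (Real.log_le_sub_one_of_pos hxy) hx.le
    linarith
  have h1 := le_mul_log_sub_add_three hx
  have h2 := mul_abs_log_le hx
  have h3 : y ≤ 2 * (y - x - x * Real.log (y / x)) + 2 * x := by
    have := mul_le_mul_of_nonneg_left (two_mul_log_le hxy) hx.le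
    linarith
  have h4 : x * |Real.log (y / x)| ≤ (y - x - x * Real.log (y / x)) + x := by
    have := mul_le_mul_of_nonneg_left (abs_log_le_sub_log hxy) hx.le
    linarith
  set φ := x * Real.log x - x + 1
  set ψ := y - x - x * Real.log (y / x)
  obtain ⟨F, hF⟩ : ∃ F, F = φ + c_v * ψ := ⟨_, rfl⟩
  have hcψ : 0 ≤ c_v * ψ := mul_nonneg hc_v.le hψ0
  have hxF : x ≤ F + 2 := by linarith
  have hψF : ψ ≤ 1 / c_v * F := by
    rw [one_div, ← div_eq_inv_mul, le_div_iff₀ hc_v]; linarith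
  have hyF : y ≤ 2 / c_v * F + 2 * F + 4 := by
    have : 2 / c_v * F = 2 * (1 / c_v * F) := by ring
    linarith
  have hlogt : c_v * (x * |Real.log (y / x)|) ≤ F + c_v * (F + 2) := by
    have := mul_le_mul_of_nonneg_left (h4.trans (add_le_add_right hxF ψ)) hc_v.le
    linarith
  have hlogx : x * |Real.log x| ≤ 2 * F + 3 := by linarith
  have hxC : c_v * C * x ≤ c_v * C * (F + 2) :=
    mul_le_mul_of_nonneg_left hxF (mul_pos hc_v hC).le
  have key : x + c_v * C * x + c_v * (x * |Real.log (y / x)|) + x * |Real.log x| + y ≤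
      (6 + 2 / c_v + c_v * C + c_v) * F + (9 + 2 * c_v * C + 2 * c_v) := by
    linarith
  have := mul_le_mul_of_nonneg_left key hC.le
  rw [← hF]
  calc _ = 1 + C * (x + c_v * C * x + c_v * (x * |Real.log (y / x)|) + x * |Real.log x| + y) := by
        field_simp
        ring
    _ ≤ _ := by linarith

/-- On a compact set of test states the relevant quantities are uniformly bounded. -/
lemma exists_bound_test_states (γ : ℝ) {K : Set (ℝ × ℝ)} (hK : IsCompact K)
    (hKsub : K ⊆ Set.Ioi (0 : ℝ) ×ˢ Set.Ioi (0 : ℝ)) :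
    ∃ C > 0, ∀ q ∈ K, q.1 + q.1 * q.2 ≤ C ∧ 1 ≤ C * (q.1 * q.2) ∧
      |Real.log (q.1 * q.2) - γ * Real.log q.1| ≤ C := by
  have hpos : ∀ q ∈ K, 0 < q.1 ∧ 0 < q.2 := fun q hq => hKsub hq
  have hcont : ContinuousOn (fun q : ℝ × ℝ => q.1 + q.1 * q.2 + (q.1 * q.2)⁻¹ +
      |Real.log (q.1 * q.2) - γ * Real.log q.1|) K := by
    have h12 : ∀ q ∈ K, q.1 * q.2 ≠ 0 := fun q hq => (mul_pos (hpos q hq).1 (hpos q hq).2).ne'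
    have h1 : ∀ q ∈ K, q.1 ≠ 0 := fun q hq => (hpos q hq).1.ne'
    fun_prop (disch := assumption)
  obtain ⟨C, hC⟩ := hK.exists_bound_of_continuousOn hcont
  refine ⟨max C 1, by positivity, fun q hq => ?_⟩
  obtain ⟨h1, h2⟩ := hpos q hq
  have h12 : 0 < q.1 * q.2 := mul_pos h1 h2
  have hb := ((le_abs_self _).trans (hC q hq)).trans (le_max_left C 1)
  have hinv : 0 < (q.1 * q.2)⁻¹ := inv_pos.2 h12
  have habs := abs_nonneg (Real.log (q.1 * q.2) - γ * Real.log q.1)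
  refine ⟨by linarith, ?_, by linarith⟩
  rw [← div_le_iff₀ h12, one_div]
  linarith

/-- Coercivity of the residual part of the relative energy: away from
a `δ`-neighbourhood of a compact set `K ⊂ (0,∞)²` of test states `(r, Θ)`, the Bregman
divergence of `H_Θ` at `(r, rΘ)` dominates `1 + ϱ + c_v ϱ |log(p/ϱ^γ)| + p`, uniformly
in `(r, Θ) ∈ K`. -/
theorem stmt_9 (c_v : ℝ) (hc_v : 0 < c_v) (γ : ℝ) (hγ : γ = 1 + 1 / c_v)
    (K : Set (ℝ × ℝ)) (hK : IsCompact K)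
    (hKsub : K ⊆ Set.Ioi (0 : ℝ) ×ˢ Set.Ioi (0 : ℝ)) :
    ∃ δ > 0, ∃ c > 0, ∀ rΘ ∈ K, ∀ ϱ p : ℝ, 0 < ϱ → 0 < p →
      δ ≤ |ϱ - rΘ.1| + |p - rΘ.1 * rΘ.2| →
      c * (1 + ϱ + c_v * ϱ * |Real.log (p / ϱ ^ γ)| + p)
        ≤ Breg c_v γ rΘ.2 rΘ.1 ϱ p := by
  obtain ⟨C, hC, hCK⟩ := exists_bound_test_states γ hK hKsub
  obtain ⟨P, hP⟩ : ∃ P, P = C * (6 + 2 / c_v + c_v * C + c_v) := ⟨_, rfl⟩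
  obtain ⟨Q, hQ⟩ : ∃ Q, Q = 1 + C * (9 + 2 * c_v * C + 2 * c_v) := ⟨_, rfl⟩
  have hP0 : 0 < P := by rw [hP]; positivity
  have hQ0 : 0 < Q := by rw [hQ]; positivity
  refine ⟨C + 2 * Q, by positivity, 1 / (2 * P * C), by positivity, ?_⟩
  rintro ⟨r, Θ⟩ hq ϱ p hϱ hp hδ
  obtain ⟨hr, hΘ⟩ : 0 < r ∧ 0 < Θ := hKsub hq
  obtain ⟨hb1, hb2, hb3⟩ := hCK _ hq
  dsimp only at hδ hb1 hb2 hb3 ⊢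
  have hrΘ : 0 < r * Θ := mul_pos hr hΘ
  obtain ⟨x, hx, rfl⟩ : ∃ x, 0 < x ∧ r * x = ϱ :=
    ⟨ϱ / r, div_pos hϱ hr, mul_div_cancel₀ ϱ hr.ne'⟩
  obtain ⟨y, hy, rfl⟩ : ∃ y, 0 < y ∧ r * Θ * y = p :=
    ⟨p / (r * Θ), div_pos hp hrΘ, mul_div_cancel₀ p hrΘ.ne'⟩
  rw [Breg_eq c_v γ Θ r x y hc_v hγ hΘ hr hx hy]
  have hkey := coercivity_normalized hc_v hC hx hy
  rw [← hP, ← hQ] at hkey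
  set F := (x * Real.log x - x + 1) + c_v * (y - x - x * Real.log (y / x))
  have hs : |Real.log (r * Θ * y / (r * x) ^ γ)| ≤
      C + |Real.log (y / x)| + 1 / c_v * |Real.log x| := by
    have heq : Real.log (r * Θ * y / (r * x) ^ γ) =
        (Real.log (r * Θ) - γ * Real.log r) + Real.log (y / x) - 1 / c_v * Real.log x := by
      rw [Real.log_div hp.ne' (Real.rpow_pos_of_pos hϱ γ).ne', Real.log_rpow hϱ,
        Real.log_mul hrΘ.ne' hy.ne', Real.log_mul hr.ne' hx.ne', Real.log_div hy.ne' hx.ne', hγ]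
      ring
    have habs : |1 / c_v * Real.log x| = 1 / c_v * |Real.log x| := by
      rw [abs_mul, abs_of_pos (one_div_pos.2 hc_v)]
    rw [heq, ← habs]
    refine (abs_sub _ _).trans (add_le_add_left ((abs_add_le _ _).trans ?_) _)
    linarith
  have hrx : r * x ≤ C * x := mul_le_mul_of_nonneg_right (by linarith) hx.le
  have hry : r * Θ * y ≤ C * y := mul_le_mul_of_nonneg_right (by linarith) hy.le
  have hterm : c_v * (r * x) * |Real.log (r * Θ * y / (r * x) ^ γ)| ≤
      c_v * (C * x) * (C + |Real.log (y / x)| + 1 / c_v * |Real.log x|) := by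
    gcongr
  have hnn : 0 ≤ c_v * (r * x) * |Real.log (r * Θ * y / (r * x) ^ γ)| := by positivity
  have hlow : 2 * Q ≤ r * x + r * Θ * y := by
    have h1 : |r * x - r| ≤ r * x + r := abs_le.2 ⟨by linarith, by linarith⟩
    have h2 : |r * Θ * y - r * Θ| ≤ r * Θ * y + r * Θ := abs_le.2 ⟨by linarith, by linarith⟩
    linarith
  set S := 1 + r * x + c_v * (r * x) * |Real.log (r * Θ * y / (r * x) ^ γ)| + r * Θ * y
    with hS
  have hSF : S ≤ 2 * P * F := by linarith
  have hS0 : 0 < S := by linarith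
  have hF0 : 0 < F := pos_of_mul_pos_right (hS0.trans_le hSF) (by positivity)
  rw [one_div, ← div_eq_inv_mul, div_le_iff₀ (by positivity)]
  have := mul_le_mul_of_nonneg_left hb2 (mul_pos (mul_pos two_pos hP0) hF0).le
  linarith
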